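/- Fix 0 < α < 1 with K_α := 2 sin²(απ) - πα sin(2απ) ≠ 0, and define ζ₀(c) = -σ(c) + μ(c)/α for small c > 0, where σ(c) = 2αc²B(c), μ(c) = 2 sinh²(αc)B(c), B(c) = c sin²(απ)/(2αc² sin²(απ) - π sin(2απ) sinh²(αc)). Let L > 0. Then there exist δ > 0, C > 0 and a positive integer N₀ such that for every integer N ≥ N₀ the equation c + ζ₀(c) = L/N has a solution c_N ∈ (0, δ), and every such solution satisfies |c_N - L/N| ≤ C N^{-3}; consequently c_N = L N^{-1} + O(N^{-3}) and ζ₀(c_N) = O(N^{-3}) as N → ∞. -/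

import Mathlib

open Complex Real Filter

/-- `B = c sin²(απ) / (2αc² sin²(απ) - π sin(2απ) sinh²(αc))`. -/
noncomputable def talbotB (α c : ℝ) : ℝ :=
  c * Real.sin (α * π) ^ 2 /
    (2 * α * c ^ 2 * Real.sin (α * π) ^ 2
      - π * Real.sin (2 * α * π) * Real.sinh (α * c) ^ 2)

/-- `σ = 2αc²B`. -/
noncomputable def talbotSigma (α c : ℝ) : ℝ := 2 * α * c ^ 2 * talbotB α c

/-- `μ = 2 sinh²(αc) B`. -/
noncomputable def talbotMu (α c : ℝ) : ℝ := 2 * Real.sinh (α * c) ^ 2 * talbotB α c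

/-- `ζ₀(c) = ζ(0) = -σ + μ/α`, the real-axis crossing of the contour shape. -/
noncomputable def talbotZeta0 (α c : ℝ) : ℝ := -talbotSigma α c + talbotMu α c / α

theorem sinh_sq_sub_sq_mem_Icc {x : ℝ} (h0 : 0 ≤ x) (h1 : x ≤ 1) :
    Real.sinh x ^ 2 - x ^ 2 ∈ Set.Icc 0 (3 * x ^ 4) := by
  have hx : |x| ≤ 1 := abs_le.2 ⟨by linarith, h1⟩
  have hpos := Real.exp_bound hx (n := 3) (by norm_num)
  have hneg := Real.exp_bound (x := -x) (by rwa [abs_neg]) (n := 3) (by norm_num)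
  rw [abs_neg] at hneg
  norm_num [Finset.sum_range_succ, Nat.factorial, abs_of_nonneg h0] at hpos hneg
  have hup : Real.sinh x ≤ x + x ^ 3 := by
    rw [Real.sinh_eq]
    have := pow_nonneg h0 3
    linarith [(abs_le.1 hpos).2, (abs_le.1 hneg).1]
  have hlow : x ≤ Real.sinh x := Real.self_le_sinh_iff.2 h0
  refine ⟨by nlinarith, ?_⟩
  have hsq : Real.sinh x ^ 2 ≤ (x + x ^ 3) ^ 2 := by
    gcongr
  have h6 : x ^ 6 ≤ x ^ 4 := pow_le_pow_of_le_one h0 h1 (by norm_num)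
  nlinarith

theorem talbotZeta0_eq {α : ℝ} (hα : α ≠ 0) (c : ℝ) :
    talbotZeta0 α c = 2 / α * (Real.sinh (α * c) ^ 2 - (α * c) ^ 2) * talbotB α c := by
  unfold talbotZeta0 talbotSigma talbotMu
  field_simp
  ring

/-- The denominator of `B` is bounded below by a multiple of `c²` for small `c`. -/
theorem le_abs_talbotB_denom {α c : ℝ} (hα0 : 0 < α) (hα1 : α < 1) (hc0 : 0 < c) (hc1 : c ≤ 1)
    (hc : 6 * π * c ^ 2 ≤
      α * |2 * Real.sin (α * π) ^ 2 - π * α * Real.sin (2 * α * π)|) :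
    α * |2 * Real.sin (α * π) ^ 2 - π * α * Real.sin (2 * α * π)| / 2 * c ^ 2 ≤
      |2 * α * c ^ 2 * Real.sin (α * π) ^ 2
        - π * Real.sin (2 * α * π) * Real.sinh (α * c) ^ 2| := by
  have hαc : α * c ≤ c := by nlinarith
  obtain ⟨hd0, hd⟩ := sinh_sq_sub_sq_mem_Icc (mul_pos hα0 hc0).le (hαc.trans hc1)
  have hd' : Real.sinh (α * c) ^ 2 - (α * c) ^ 2 ≤ 3 * c ^ 4 := hd.trans (by gcongr)
  set K := 2 * Real.sin (α * π) ^ 2 - π * α * Real.sin (2 * α * π) with hK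
  set d := Real.sinh (α * c) ^ 2 - (α * c) ^ 2 with hd_def
  have hden : 2 * α * c ^ 2 * Real.sin (α * π) ^ 2
      - π * Real.sin (2 * α * π) * Real.sinh (α * c) ^ 2
      = α * K * c ^ 2 - π * Real.sin (2 * α * π) * d := by
    rw [hK, hd_def]; ring
  have hP : |π * Real.sin (2 * α * π) * d| ≤ π * (3 * c ^ 4) := by
    rw [abs_mul, abs_mul, abs_of_pos Real.pi_pos, abs_of_nonneg hd0]
    have := Real.abs_sin_le_one (2 * α * π)
    calc π * |Real.sin (2 * α * π)| * d ≤ π * 1 * (3 * c ^ 4) := by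
          gcongr
      _ = _ := by ring
  have htri := abs_sub_abs_le_abs_sub (α * K * c ^ 2) (π * Real.sin (2 * α * π) * d)
  rw [abs_mul, abs_mul, abs_of_pos hα0, abs_of_nonneg (sq_nonneg c)] at htri
  rw [hden]
  nlinarith [mul_le_mul_of_nonneg_right hc (sq_nonneg c)]

theorem abs_talbotZeta0_le {α c : ℝ} (hα0 : 0 < α) (hα1 : α < 1) (hc0 : 0 < c) (hc1 : c ≤ 1)
    (hK : 2 * Real.sin (α * π) ^ 2 - π * α * Real.sin (2 * α * π) ≠ 0)
    (hc : 6 * π * c ^ 2 ≤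
      α * |2 * Real.sin (α * π) ^ 2 - π * α * Real.sin (2 * α * π)|) :
    |talbotZeta0 α c| ≤
      12 / (α ^ 2 * |2 * Real.sin (α * π) ^ 2 - π * α * Real.sin (2 * α * π)|) * c ^ 3 := by
  have hden := le_abs_talbotB_denom hα0 hα1 hc0 hc1 hc
  have hαc : α * c ≤ c := by nlinarith
  obtain ⟨hd0, hd⟩ := sinh_sq_sub_sq_mem_Icc (mul_pos hα0 hc0).le (hαc.trans hc1)
  have hd' : Real.sinh (α * c) ^ 2 - (α * c) ^ 2 ≤ 3 * c ^ 4 := hd.trans (by gcongr)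
  have hK' := abs_pos.2 hK
  set K := |2 * Real.sin (α * π) ^ 2 - π * α * Real.sin (2 * α * π)|
  have hB : |talbotB α c| ≤ c * 1 / (α * K / 2 * c ^ 2) := by
    rw [talbotB, abs_div, abs_mul, abs_of_pos hc0, abs_of_nonneg (sq_nonneg (Real.sin _))]
    gcongr
    exact Real.sin_sq_le_one _
  rw [talbotZeta0_eq hα0.ne', abs_mul, abs_mul, abs_of_nonneg hd0, abs_of_pos (by positivity)]
  calc 2 / α * (Real.sinh (α * c) ^ 2 - (α * c) ^ 2) * |talbotB α c|
      ≤ 2 / α * (3 * c ^ 4) * (c * 1 / (α * K / 2 * c ^ 2)) := by gcongr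
    _ = 12 / (α ^ 2 * K) * c ^ 3 := by field_simp; ring

theorem continuousAt_talbotZeta0 {α c : ℝ}
    (h : 2 * α * c ^ 2 * Real.sin (α * π) ^ 2
      - π * Real.sin (2 * α * π) * Real.sinh (α * c) ^ 2 ≠ 0) :
    ContinuousAt (talbotZeta0 α) c := by
  have hB : ContinuousAt (talbotB α) c := by
    unfold talbotB
    exact ContinuousAt.div (by fun_prop) (by fun_prop) h
  unfold talbotZeta0 talbotSigma talbotMu
  fun_prop

/-- A cubically small perturbation of the identity near `0⁺`: the equation `c + g c = L / N` is
solvable for large `N`, with every small solution within `O(N⁻³)` of `L / N`. -/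
theorem exists_add_eq_div_of_abs_le_cube {g : ℝ → ℝ} {δ M L : ℝ} (hδ : 0 < δ) (hM : 0 < M)
    (hL : 0 < L) (hMδ : M * δ ^ 2 ≤ 1 / 2) (hg : ContinuousOn g (Set.Ioo 0 δ))
    (hgM : ∀ c ∈ Set.Ioo 0 δ, |g c| ≤ M * c ^ 3) :
    ∃ C > (0:ℝ), ∃ N₀ : ℕ, 0 < N₀ ∧ ∀ N : ℕ, N₀ ≤ N →
      (∃ c ∈ Set.Ioo (0:ℝ) δ, c + g c = L / N) ∧
      (∀ c ∈ Set.Ioo (0:ℝ) δ, c + g c = L / N →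
        |c - L / N| ≤ C / (N : ℝ) ^ 3 ∧ |g c| ≤ C / (N : ℝ) ^ 3) := by
  have hhalf : ∀ c ∈ Set.Ioo 0 δ, |g c| ≤ c / 2 := by
    rintro c ⟨hc0, hcδ⟩
    calc |g c| ≤ M * c ^ 3 := hgM c ⟨hc0, hcδ⟩
      _ = M * c ^ 2 * c := by ring
      _ ≤ M * δ ^ 2 * c := by gcongr
      _ ≤ 1 / 2 * c := by gcongr
      _ = c / 2 := by ring
  refine ⟨M * (2 * L) ^ 3, by positivity, ⌊2 * L / δ⌋₊ + 1, by simp, fun N hN ↦ ?_⟩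
  have hNlt : 2 * L / δ < N := (Nat.lt_floor_add_one _).trans_le (by exact_mod_cast hN)
  have hN0 : (0:ℝ) < N := lt_trans (by positivity) hNlt
  have ht : 0 < L / N := by positivity
  have htδ : 2 * (L / N) < δ := by
    rw [div_lt_iff₀ hδ] at hNlt
    rw [← mul_div_assoc, div_lt_iff₀ hN0]
    linarith
  refine ⟨?_, fun c hc hcN ↦ ?_⟩
  · have hsub : Set.Icc (L / N / 2) (2 * (L / N)) ⊆ Set.Ioo 0 δ :=
      fun x hx ↦ ⟨by linarith [hx.1], by linarith [hx.2]⟩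
    have hle : L / N / 2 ≤ 2 * (L / N) := by linarith
    have hl := abs_le.1 (hhalf _ (hsub (Set.left_mem_Icc.2 hle)))
    have hr := abs_le.1 (hhalf _ (hsub (Set.right_mem_Icc.2 hle)))
    obtain ⟨c, hc, hcN⟩ := intermediate_value_Icc hle (continuousOn_id.add (hg.mono hsub))
      (show L / N ∈ Set.Icc _ _ from
        ⟨by simp only [Pi.add_apply, id]; linarith, by simp only [Pi.add_apply, id]; linarith⟩)
    exact ⟨c, hsub hc, hcN⟩
  · have hc2 : c ≤ 2 * (L / N) := by linarith [(abs_le.1 (hhalf c hc)).1]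
    have hgc : |g c| ≤ M * (2 * L) ^ 3 / (N : ℝ) ^ 3 := by
      calc |g c| ≤ M * c ^ 3 := hgM c hc
        _ ≤ M * (2 * (L / N)) ^ 3 := by
          have := hc.1.le
          gcongr
        _ = M * (2 * L) ^ 3 / (N : ℝ) ^ 3 := by ring
    refine ⟨?_, hgc⟩
    rwa [show c - L / N = -g c by linarith, abs_neg]

/-- **Solvability and asymptotics of the roundoff-control equation.**
For fixed `0 < α < 1` with `K_α ≠ 0` and `L > 0`, for all large `N` the
equation `c + ζ₀(c) = L/N` has a solution `c ∈ (0, δ)`, and every such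
solution satisfies `|c - L/N| ≤ C N⁻³` and `|ζ₀(c)| ≤ C N⁻³`; hence
`c_N = L/N + O(N⁻³)` and `ζ₀(c_N) = O(N⁻³)` as `N → ∞`. -/
theorem roundoff_equation_solution (α : ℝ) (hα0 : 0 < α) (hα1 : α < 1)
    (hK : 2 * Real.sin (α * π) ^ 2 - π * α * Real.sin (2 * α * π) ≠ 0)
    (L : ℝ) (hL : 0 < L) :
    ∃ δ > (0:ℝ), ∃ C > (0:ℝ), ∃ N₀ : ℕ, 0 < N₀ ∧ ∀ N : ℕ, N₀ ≤ N →
      (∃ c ∈ Set.Ioo (0:ℝ) δ, c + talbotZeta0 α c = L / N) ∧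
      (∀ c ∈ Set.Ioo (0:ℝ) δ, c + talbotZeta0 α c = L / N →
        |c - L / N| ≤ C / (N : ℝ) ^ 3 ∧ |talbotZeta0 α c| ≤ C / (N : ℝ) ^ 3) := by
  have hK' := abs_pos.2 hK
  set K := |2 * Real.sin (α * π) ^ 2 - π * α * Real.sin (2 * α * π)|
  have hsmall : ∀ a b : ℝ, 0 < b → ∀ᶠ x : ℝ in nhdsWithin 0 (Set.Ioi 0), a * x ^ 2 < b := by
    intro a b hb
    have : ContinuousAt (fun x : ℝ ↦ a * x ^ 2) 0 := by fun_prop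
    exact (this.eventually (gt_mem_nhds (by simpa using hb))).filter_mono nhdsWithin_le_nhds
  obtain ⟨δ, ⟨⟨⟨h1, hπ⟩, hM⟩, hδ⟩⟩ := (((hsmall 1 1 one_pos).and
    (hsmall (6 * π) (α * K) (by positivity))).and
    (hsmall (12 / (α ^ 2 * K)) (1 / 2) (by norm_num))).and self_mem_nhdsWithin |>.exists
  have hle : ∀ c ∈ Set.Ioo 0 δ, c ≤ 1 ∧ 6 * π * c ^ 2 ≤ α * K := by
    rintro c ⟨hc0, hcδ⟩
    refine ⟨by nlinarith, le_trans ?_ hπ.le⟩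
    gcongr
  refine ⟨δ, hδ, exists_add_eq_div_of_abs_le_cube hδ (by positivity) hL hM.le ?_
    fun c hc ↦ abs_talbotZeta0_le hα0 hα1 hc.1 (hle c hc).1 hK (hle c hc).2⟩
  intro c hc
  have hc0 := hc.1
  refine (continuousAt_talbotZeta0 (abs_pos.1 (lt_of_lt_of_le ?_
    (le_abs_talbotB_denom hα0 hα1 hc0 (hle c hc).1 (hle c hc).2)))).continuousWithinAt
  positivity
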